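/- arXiv:2104.08115 — 2 statements merged into one kernel-verified Lean document; each statement's English description precedes it below -/
import Mathlib

section
/- For every x̂₀∈ℝ² and every R>0, the function x ↦ ∫_{B̂_R(x̂₀)} (k₁(x,ŷ)+k(x,ŷ)) dŷ is well defined for x∈ℝ³ with x₁>0 (the integrand is integrable on B̂_R(x̂₀)), and it tends to 1/2 as x tends to (0,x̂₀) within the half-space {x₁>0}. -/
open MeasureTheory Filter

noncomputable section

/-- The quantity `D(x, ŷ)` from the double layer potential kernels. -/
def Dden (x : ℝ × ℝ × ℝ) (y : ℝ × ℝ) : ℝ :=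
  (x.1 ^ 2 + (x.2.1 - y.1) ^ 2) ^ 2 + 16 * (x.2.2 - y.2 + (1 / 2) * y.1 * x.1) ^ 2

/-- The kernel `k₁(x, ŷ)`. -/
def k1 (c : ℝ) (x : ℝ × ℝ × ℝ) (y : ℝ × ℝ) : ℝ :=
  2 * c * (x.1 ^ 2 + (x.2.1 - y.1) ^ 2) * x.1 * Dden x y ^ (-(3 : ℝ) / 2)

/-- The kernel `k(x, ŷ)`. -/
def kker (c : ℝ) (x : ℝ × ℝ × ℝ) (y : ℝ × ℝ) : ℝ :=
  8 * c * (x.2.1 - y.1) * (x.2.2 - y.2 + (1 / 2) * y.1 * x.1) * Dden x y ^ (-(3 : ℝ) / 2)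

/-- The homogeneous distance `d̃` on the vertical plane `Π ≅ ℝ²`. -/
def dt (a b : ℝ × ℝ) : ℝ := ((a.1 - b.1) ^ 4 + 16 * (a.2 - b.2) ^ 2) ^ ((1 : ℝ) / 4)

/-- The ball of `d̃` of radius `r` centered at `a`. -/
def bhat (r : ℝ) (a : ℝ × ℝ) : Set (ℝ × ℝ) := {b | dt a b < r}

/-- The candidate fundamental solution `Γ_c(x, y)` on the first Heisenberg group. -/
def Gam (c : ℝ) (x y : ℝ × ℝ × ℝ) : ℝ :=
  c * (((x.1 - y.1) ^ 2 + (x.2.1 - y.2.1) ^ 2) ^ 2 +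
    16 * (x.2.2 - y.2.2 - (1 / 2) * (y.1 * x.2.1 - y.2.1 * x.1)) ^ 2) ^ (-(1 : ℝ) / 2)

/-- Derivative along the left-invariant vector field `X₁ = ∂₁ - (x₂/2) ∂₃`. -/
def X1d (f : ℝ × ℝ × ℝ → ℝ) (x : ℝ × ℝ × ℝ) : ℝ :=
  fderiv ℝ f x ((1 : ℝ), (0 : ℝ), -(x.2.1 / 2))

/-- Derivative along the left-invariant vector field `X₂ = ∂₂ + (x₁/2) ∂₃`. -/
def X2d (f : ℝ × ℝ × ℝ → ℝ) (x : ℝ × ℝ × ℝ) : ℝ :=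
  fderiv ℝ f x ((0 : ℝ), (1 : ℝ), x.1 / 2)

/-- The sub-Laplacian `Δ_ℍ = X₁² + X₂²`. -/
def subLap (f : ℝ × ℝ × ℝ → ℝ) (x : ℝ × ℝ × ℝ) : ℝ :=
  X1d (X1d f) x + X2d (X2d f) x

/-- `c` is the normalizing constant making `Γ_c` the fundamental solution of `Δ_ℍ`. -/
def IsNormalizing (c : ℝ) : Prop :=
  ∀ φ : ℝ × ℝ × ℝ → ℝ, ContDiff ℝ (⊤ : ℕ∞) φ → HasCompactSupport φ →
    ∫ y, Gam c 0 y * subLap φ y = -φ 0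

/-- The fourth power of the homogeneous gauge on the Heisenberg group. -/
def gauge4 (y : ℝ × ℝ × ℝ) : ℝ := (y.1 ^ 2 + y.2.1 ^ 2) ^ 2 + 16 * y.2.2 ^ 2

theorem fderiv_apply_of_hasDerivAt_line {f : ℝ × ℝ × ℝ → ℝ} {x v : ℝ × ℝ × ℝ} {d : ℝ}
    (hf : Differentiable ℝ f)
    (h : HasDerivAt (fun t : ℝ => f (x.1 + t * v.1, x.2.1 + t * v.2.1, x.2.2 + t * v.2.2)) d 0) :
    fderiv ℝ f x v = d := by
  rw [← (hf x).lineDeriv_eq_fderiv]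
  exact h.deriv

theorem contDiff_gauge4 : ContDiff ℝ (⊤ : ℕ∞) gauge4 := by
  unfold gauge4
  fun_prop

theorem hasDerivAt_line (a b : ℝ) : HasDerivAt (fun t : ℝ => a + t * b) b 0 :=
  (((hasDerivAt_id (0 : ℝ)).mul_const b).const_add a).congr_deriv (one_mul b)

theorem fderiv_gauge4_apply (x v : ℝ × ℝ × ℝ) :
    fderiv ℝ gauge4 x v =
      4 * (x.1 ^ 2 + x.2.1 ^ 2) * (x.1 * v.1 + x.2.1 * v.2.1) + 32 * x.2.2 * v.2.2 := by
  refine fderiv_apply_of_hasDerivAt_line (contDiff_gauge4.differentiable (by simp)) ?_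
  refine (((((hasDerivAt_line x.1 v.1).pow 2).add ((hasDerivAt_line x.2.1 v.2.1).pow 2)).pow
    2).add (((hasDerivAt_line x.2.2 v.2.2).pow 2).const_mul 16)).congr_deriv ?_
  simp
  ring

theorem X1d_gauge4 (x : ℝ × ℝ × ℝ) :
    X1d gauge4 x = 4 * (x.1 ^ 2 + x.2.1 ^ 2) * x.1 - 16 * (x.2.1 * x.2.2) := by
  rw [X1d, fderiv_gauge4_apply]
  ring

theorem X2d_gauge4 (x : ℝ × ℝ × ℝ) :
    X2d gauge4 x = 4 * (x.1 ^ 2 + x.2.1 ^ 2) * x.2.1 + 16 * (x.1 * x.2.2) := by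
  rw [X2d, fderiv_gauge4_apply]
  ring

theorem X1d_X1d_gauge4 (x : ℝ × ℝ × ℝ) :
    X1d (X1d gauge4) x = 12 * (x.1 ^ 2 + x.2.1 ^ 2) := by
  have e : X1d gauge4 = fun x => 4 * (x.1 ^ 2 + x.2.1 ^ 2) * x.1 - 16 * (x.2.1 * x.2.2) :=
    funext X1d_gauge4
  rw [e]
  refine fderiv_apply_of_hasDerivAt_line (by fun_prop) ?_
  refine ((((((hasDerivAt_line x.1 1).pow 2).add ((hasDerivAt_line x.2.1 0).pow 2)).const_mul
    4).mul (hasDerivAt_line x.1 1)).sub (((hasDerivAt_line x.2.1 0).mul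
      (hasDerivAt_line x.2.2 (-(x.2.1 / 2)))).const_mul 16)).congr_deriv ?_
  simp
  ring

theorem X2d_X2d_gauge4 (x : ℝ × ℝ × ℝ) :
    X2d (X2d gauge4) x = 12 * (x.1 ^ 2 + x.2.1 ^ 2) := by
  have e : X2d gauge4 = fun x => 4 * (x.1 ^ 2 + x.2.1 ^ 2) * x.2.1 + 16 * (x.1 * x.2.2) :=
    funext X2d_gauge4
  rw [e]
  refine fderiv_apply_of_hasDerivAt_line (by fun_prop) ?_
  refine ((((((hasDerivAt_line x.1 0).pow 2).add ((hasDerivAt_line x.2.1 1).pow 2)).const_mul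
    4).mul (hasDerivAt_line x.2.1 1)).add (((hasDerivAt_line x.1 0).mul
      (hasDerivAt_line x.2.2 (x.1 / 2))).const_mul 16)).congr_deriv ?_
  simp
  ring

theorem fderiv_comp_gauge4_apply {g : ℝ → ℝ} (hg : Differentiable ℝ g) (x v : ℝ × ℝ × ℝ) :
    fderiv ℝ (fun y => g (gauge4 y)) x v = deriv g (gauge4 x) * fderiv ℝ gauge4 x v := by
  have h := (hg (gauge4 x)).hasDerivAt.comp_hasFDerivAt x
    (contDiff_gauge4.differentiable (by simp) x).hasFDerivAt
  have h2 : fderiv ℝ (fun y => g (gauge4 y)) x = deriv g (gauge4 x) • fderiv ℝ gauge4 x :=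
    h.fderiv
  rw [h2]
  rfl

theorem fderiv_comp_gauge4_mul_apply {g : ℝ → ℝ} (hg : Differentiable ℝ g)
    {P : ℝ × ℝ × ℝ → ℝ} (hP : Differentiable ℝ P) (x v : ℝ × ℝ × ℝ) :
    fderiv ℝ (fun y => g (gauge4 y) * P y) x v =
      deriv g (gauge4 x) * fderiv ℝ gauge4 x v * P x + g (gauge4 x) * fderiv ℝ P x v := by
  have hgN : Differentiable ℝ fun y => g (gauge4 y) :=
    hg.comp (contDiff_gauge4.differentiable (by simp))
  rw [fderiv_fun_mul (hgN x) (hP x)]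
  simp only [add_apply, smul_apply, smul_eq_mul,
    fderiv_comp_gauge4_apply hg]
  ring

theorem subLap_comp_gauge4 {g : ℝ → ℝ} (hg : ContDiff ℝ (⊤ : ℕ∞) g) (x : ℝ × ℝ × ℝ) :
    subLap (fun y => g (gauge4 y)) x =
      (x.1 ^ 2 + x.2.1 ^ 2) *
        (24 * deriv g (gauge4 x) + 16 * gauge4 x * deriv (deriv g) (gauge4 x)) := by
  have hd : Differentiable ℝ g := hg.differentiable (by simp)
  have hd' : Differentiable ℝ (deriv g) :=
    (contDiff_infty_iff_deriv.1 hg).2.differentiable (by simp)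
  have e1 : X1d (fun y => g (gauge4 y)) = fun y => deriv g (gauge4 y) * X1d gauge4 y :=
    funext fun y => fderiv_comp_gauge4_apply hd y _
  have e2 : X2d (fun y => g (gauge4 y)) = fun y => deriv g (gauge4 y) * X2d gauge4 y :=
    funext fun y => fderiv_comp_gauge4_apply hd y _
  have d1 : Differentiable ℝ (X1d gauge4) := by
    rw [funext X1d_gauge4]
    fun_prop
  have d2 : Differentiable ℝ (X2d gauge4) := by
    rw [funext X2d_gauge4]
    fun_prop
  have f1 : X1d (fun y => deriv g (gauge4 y) * X1d gauge4 y) x =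
      deriv (deriv g) (gauge4 x) * X1d gauge4 x * X1d gauge4 x +
        deriv g (gauge4 x) * X1d (X1d gauge4) x :=
    fderiv_comp_gauge4_mul_apply hd' d1 x _
  have f2 : X2d (fun y => deriv g (gauge4 y) * X2d gauge4 y) x =
      deriv (deriv g) (gauge4 x) * X2d gauge4 x * X2d gauge4 x +
        deriv g (gauge4 x) * X2d (X2d gauge4) x :=
    fderiv_comp_gauge4_mul_apply hd' d2 x _
  rw [subLap, e1, e2, f1, f2, X1d_X1d_gauge4, X2d_X2d_gauge4, X1d_gauge4, X2d_gauge4]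
  simp only [gauge4]
  ring

theorem integrable_of_bounded_of_compact {E : Type*} [TopologicalSpace E] [T2Space E]
    [MeasurableSpace E] [OpensMeasurableSpace E] {μ : Measure E} [IsFiniteMeasureOnCompacts μ]
    {f : E → ℝ} (hf : Measurable f) {C : ℝ} (hC : ∀ x, |f x| ≤ C) {K : Set E}
    (hK : IsCompact K) (h0 : ∀ x, x ∉ K → f x = 0) : Integrable f μ := by
  refine (integrableOn_iff_integrable_of_support_subset (s := K) fun x hx => ?_).1
    (Measure.integrableOn_of_bounded hK.measure_ne_top hf.aestronglyMeasurable
      (ae_of_all _ hC))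
  by_contra h
  exact hx (h0 x h)

theorem integral_comp_sq_add_sq (J : ℝ → ℝ) :
    ∫ z : ℝ × ℝ, J (z.1 ^ 2 + z.2 ^ 2) = Real.pi * ∫ w in Set.Ioi 0, J w := by
  rw [← integral_comp_polarCoord_symm, ← integral_comp_rpow_Ioi_of_pos (p := 2) (by norm_num)]
  have h : ∀ p : ℝ × ℝ, p.1 • J ((polarCoord.symm p).1 ^ 2 + (polarCoord.symm p).2 ^ 2) =
      (p.1 * J (p.1 ^ 2)) * (fun _ : ℝ => (1 : ℝ)) p.2 := by
    intro p
    have : (polarCoord.symm p).1 ^ 2 + (polarCoord.symm p).2 ^ 2 = p.1 ^ 2 := by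
      simp only [polarCoord_symm_apply]
      linear_combination p.1 ^ 2 * Real.sin_sq_add_cos_sq p.2
    rw [this, smul_eq_mul, mul_one]
  simp_rw [h]
  rw [polarCoord_target, Measure.volume_eq_prod,
    setIntegral_prod_mul (fun r => r * J (r ^ 2)) (fun _ => (1 : ℝ))]
  have h2 : ∀ r : ℝ, ((2 : ℝ) * r ^ ((2 : ℝ) - 1)) • J (r ^ (2 : ℝ)) = 2 * (r * J (r ^ 2)) := by
    intro r
    rw [show (2 : ℝ) - 1 = 1 by norm_num, Real.rpow_one, Real.rpow_two, smul_eq_mul, mul_assoc]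
  simp_rw [h2]
  rw [integral_const_mul]
  simp
  rw [max_eq_left (by positivity)]
  ring

theorem integral_abs_cos : ∫ θ in Set.Ioo (-Real.pi) Real.pi, |Real.cos θ| = 4 := by
  have hpi := Real.pi_pos
  have hi : ∀ a b : ℝ, IntervalIntegrable (fun θ => |Real.cos θ|) volume a b := fun a b =>
    (Real.continuous_cos.abs).intervalIntegrable a b
  rw [← integral_Ioc_eq_integral_Ioo, ← intervalIntegral.integral_of_le (by linarith),
    ← intervalIntegral.integral_add_adjacent_intervals (hi _ (Real.pi / 2)) (hi _ _),
    ← intervalIntegral.integral_add_adjacent_intervals (hi _ (-(Real.pi / 2))) (hi _ _)]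
  have h1 : ∫ θ in (-Real.pi)..(-(Real.pi / 2)), |Real.cos θ| =
      ∫ θ in (-Real.pi)..(-(Real.pi / 2)), -Real.cos θ := by
    refine intervalIntegral.integral_congr fun θ hθ => ?_
    rw [Set.uIcc_of_le (by linarith)] at hθ
    refine abs_of_nonpos ?_
    rw [← Real.cos_neg]
    exact Real.cos_nonpos_of_pi_div_two_le_of_le (by linarith [hθ.2]) (by linarith [hθ.1])
  have h2 : ∫ θ in (-(Real.pi / 2))..(Real.pi / 2), |Real.cos θ| =
      ∫ θ in (-(Real.pi / 2))..(Real.pi / 2), Real.cos θ := by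
    refine intervalIntegral.integral_congr fun θ hθ => ?_
    rw [Set.uIcc_of_le (by linarith)] at hθ
    exact abs_of_nonneg (Real.cos_nonneg_of_mem_Icc hθ)
  have h3 : ∫ θ in (Real.pi / 2)..Real.pi, |Real.cos θ| =
      ∫ θ in (Real.pi / 2)..Real.pi, -Real.cos θ := by
    refine intervalIntegral.integral_congr fun θ hθ => ?_
    rw [Set.uIcc_of_le (by linarith)] at hθ
    exact abs_of_nonpos
      (Real.cos_nonpos_of_pi_div_two_le_of_le hθ.1 (by linarith [hθ.2]))
  rw [h1, h2, h3, intervalIntegral.integral_neg, intervalIntegral.integral_neg, integral_cos,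
    integral_cos, integral_cos]
  simp
  norm_num

theorem abs_mul_rpow_le_one (w τ : ℝ) :
    |(|w| * (w ^ 2 + τ ^ 2) ^ (-(1 : ℝ) / 2))| ≤ 1 := by
  rw [neg_div, Real.rpow_neg (by positivity), ← Real.sqrt_eq_rpow, ← div_eq_mul_inv, abs_div,
    abs_abs, abs_of_nonneg (Real.sqrt_nonneg _)]
  exact div_le_one_of_le₀ (Real.abs_le_sqrt (by nlinarith [sq_nonneg τ])) (Real.sqrt_nonneg _)

/-- The weighted radial integral over the Heisenberg group reduces to one dimension. -/
theorem integral_gauge4_weighted {F : ℝ → ℝ} (hF : Continuous F) (h0 : ∀ n, 2 < n → F n = 0) :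
    ∫ y : ℝ × ℝ × ℝ, (y.1 ^ 2 + y.2.1 ^ 2) * gauge4 y ^ (-(1 : ℝ) / 2) * F (gauge4 y) =
      Real.pi / 2 * ∫ r in Set.Ioi 0, r * F (r ^ 2) := by
  have hFm := hF.measurable
  obtain ⟨C, hC⟩ : ∃ C, ∀ n, 0 ≤ n → |F n| ≤ C := by
    obtain ⟨C, hC⟩ := (isCompact_Icc (a := (0 : ℝ)) (b := 2)).exists_bound_of_continuousOn
      hF.continuousOn
    refine ⟨C, fun n hn => ?_⟩
    by_cases h : n ≤ 2
    · exact hC n ⟨hn, h⟩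
    · rw [h0 n (not_le.1 h), abs_zero]
      exact (norm_nonneg _).trans (hC 0 ⟨le_rfl, by norm_num⟩)
  set H : ℝ → ℝ → ℝ := fun w τ =>
    |w| * (w ^ 2 + τ ^ 2) ^ (-(1 : ℝ) / 2) * F (w ^ 2 + τ ^ 2) with hH
  have hHm : Measurable fun p : ℝ × ℝ => H p.1 p.2 := by
    simp only [hH]
    exact (Measurable.mul (by fun_prop) (Measurable.pow_const (by fun_prop) _)).mul
      (hFm.comp (by fun_prop))
  have hHC : ∀ w τ, |H w τ| ≤ C := by
    intro w τ
    simp only [hH]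
    rw [abs_mul]
    calc _ ≤ 1 * C := mul_le_mul (abs_mul_rpow_le_one w τ) (hC _ (by positivity))
          (abs_nonneg _) zero_le_one
      _ = C := one_mul C
  have hH0 : ∀ w τ, 2 < w ^ 2 + τ ^ 2 → H w τ = 0 := by
    intro w τ h
    simp only [hH, h0 _ h, mul_zero]
  have step1 : ∫ y : ℝ × ℝ × ℝ,
      (y.1 ^ 2 + y.2.1 ^ 2) * gauge4 y ^ (-(1 : ℝ) / 2) * F (gauge4 y) =
      ∫ z : ℝ × ℝ, (fun w => ∫ t, H w (4 * t)) (z.1 ^ 2 + z.2 ^ 2) := by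
    have hint : Integrable (fun q : (ℝ × ℝ) × ℝ => H (q.1.1 ^ 2 + q.1.2 ^ 2) (4 * q.2))
        ((volume : Measure (ℝ × ℝ)).prod volume) := by
      refine integrable_of_bounded_of_compact (hHm.comp (by fun_prop :
        Measurable fun q : (ℝ × ℝ) × ℝ => (q.1.1 ^ 2 + q.1.2 ^ 2, 4 * q.2)))
        (fun q => hHC _ _) ((isCompact_Icc (a := (-2 : ℝ)) (b := 2)).prod
          (isCompact_Icc (a := (-2 : ℝ)) (b := 2)) |>.prod
            (isCompact_Icc (a := (-2 : ℝ)) (b := 2))) fun q hq => hH0 _ _ ?_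
      by_contra! h
      refine hq ⟨⟨abs_le.1 ?_, abs_le.1 ?_⟩, abs_le.1 ?_⟩ <;>
        refine abs_le_of_sq_le_sq ?_ (by norm_num) <;>
        nlinarith [sq_nonneg q.1.1, sq_nonneg q.1.2, sq_nonneg q.2,
          sq_nonneg (q.1.1 ^ 2 + q.1.2 ^ 2 - 2)]
    rw [← (volume_preserving_prodAssoc (α₁ := ℝ) (β₁ := ℝ) (γ₁ := ℝ)).integral_comp
      MeasurableEquiv.prodAssoc.measurableEmbedding, ← integral_prod _ hint]
    refine integral_congr_ae (ae_of_all _ fun q => ?_)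
    have hg : gauge4 (q.1.1, q.1.2, q.2) = (q.1.1 ^ 2 + q.1.2 ^ 2) ^ 2 + (4 * q.2) ^ 2 := by
      simp only [gauge4]
      ring
    simp only [MeasurableEquiv.prodAssoc, MeasurableEquiv.coe_mk, Equiv.prodAssoc_apply, hH,
      hg, abs_of_nonneg (by positivity : 0 ≤ q.1.1 ^ 2 + q.1.2 ^ 2)]
  have step2 : ∀ w, ∫ t, H w (4 * t) = 1 / 4 * ∫ τ, H w τ := by
    intro w
    rw [Measure.integral_comp_mul_left (fun τ => H w τ) 4, smul_eq_mul,
      abs_of_pos (by norm_num)]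
    norm_num
  have step3 : ∫ w in Set.Ioi 0, ∫ τ, H w τ = 1 / 2 * ∫ p : ℝ × ℝ, H p.1 p.2 := by
    have hint : Integrable (fun p : ℝ × ℝ => H p.1 p.2)
        ((volume : Measure ℝ).prod volume) := by
      refine integrable_of_bounded_of_compact hHm (fun q => hHC _ _)
        ((isCompact_Icc (a := (-2 : ℝ)) (b := 2)).prod
          (isCompact_Icc (a := (-2 : ℝ)) (b := 2))) fun q hq => hH0 _ _ ?_
      by_contra! h
      refine hq ⟨abs_le.1 ?_, abs_le.1 ?_⟩ <;>
        refine abs_le_of_sq_le_sq ?_ (by norm_num) <;>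
        nlinarith [sq_nonneg q.1, sq_nonneg q.2]
    rw [Measure.volume_eq_prod, integral_prod _ hint]
    have h := integral_comp_abs (f := fun w => ∫ τ, H w τ)
    have habs : ∀ w τ, H |w| τ = H w τ := fun w τ => by simp only [hH, abs_abs, sq_abs]
    simp only [habs] at h
    rw [h]
    ring
  have step4 : ∫ p : ℝ × ℝ, H p.1 p.2 = 4 * ∫ r in Set.Ioi 0, r * F (r ^ 2) := by
    rw [← integral_comp_polarCoord_symm]
    have h : ∀ p ∈ polarCoord.target,
        p.1 • H (polarCoord.symm p).1 (polarCoord.symm p).2 =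
        (p.1 * F (p.1 ^ 2)) * |Real.cos p.2| := by
      intro p hp
      have hp1 : 0 < p.1 := hp.1
      have : (polarCoord.symm p).1 ^ 2 + (polarCoord.symm p).2 ^ 2 = p.1 ^ 2 := by
        simp only [polarCoord_symm_apply]
        linear_combination p.1 ^ 2 * Real.sin_sq_add_cos_sq p.2
      simp only [hH, this, smul_eq_mul]
      rw [neg_div, Real.rpow_neg (by positivity), ← Real.sqrt_eq_rpow, Real.sqrt_sq hp1.le,
        polarCoord_symm_apply, abs_mul, abs_of_pos hp1]
      field_simp
    rw [setIntegral_congr_fun polarCoord.open_target.measurableSet h, polarCoord_target,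
      Measure.volume_eq_prod, setIntegral_prod_mul (fun r => r * F (r ^ 2))
      (fun θ => |Real.cos θ|), integral_abs_cos, mul_comm]
  rw [step1, integral_comp_sq_add_sq fun w => ∫ t, H w (4 * t)]
  simp_rw [step2]
  rw [integral_const_mul, step3, step4]
  ring

theorem deriv_eq_zero_of_vanishing {g : ℝ → ℝ} {a : ℝ} (h0 : ∀ n, a < n → g n = 0) {n : ℝ}
    (hn : a < n) : deriv g n = 0 := by
  have : g =ᶠ[nhds n] fun _ => 0 := by
    filter_upwards [lt_mem_nhds hn] with m hm using h0 m hm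
  rw [this.deriv_eq, deriv_const]

theorem integral_radial_profile {g : ℝ → ℝ} (hg : ContDiff ℝ (⊤ : ℕ∞) g)
    (h0 : ∀ n, 2 < n → g n = 0) :
    ∫ r in Set.Ioi 0, r * (24 * deriv g (r ^ 2) + 16 * r ^ 2 * deriv (deriv g) (r ^ 2)) =
      -(4 * g 0) := by
  have hg' : ContDiff ℝ (⊤ : ℕ∞) (deriv g) := (contDiff_infty_iff_deriv.1 hg).2
  set A : ℝ → ℝ := fun r => 8 * r ^ 2 * deriv g (r ^ 2) + 4 * g (r ^ 2) with hA
  have hAc : ContDiff ℝ (⊤ : ℕ∞) A := by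
    have h1 : ContDiff ℝ (⊤ : ℕ∞) fun r : ℝ => r ^ 2 := by fun_prop
    exact ((contDiff_const.mul h1).mul (hg'.comp h1)).add (contDiff_const.mul (hg.comp h1))
  have hAs : HasCompactSupport A := by
    refine HasCompactSupport.intro' (isCompact_Icc (a := (-2 : ℝ)) (b := 2)) isClosed_Icc
      fun r hr => ?_
    have : 2 < r ^ 2 := by
      by_contra! h
      exact hr (abs_le.1 (abs_le_of_sq_le_sq (by linarith) (by norm_num)))
    simp only [hA, h0 _ this, deriv_eq_zero_of_vanishing h0 this, mul_zero, add_zero]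
  have hd : ∀ r, deriv A r =
      r * (24 * deriv g (r ^ 2) + 16 * r ^ 2 * deriv (deriv g) (r ^ 2)) := by
    intro r
    have hsq : HasDerivAt (fun r : ℝ => r ^ 2) (2 * r) r :=
      (hasDerivAt_pow 2 r).congr_deriv (by norm_num)
    have h1 : HasDerivAt (fun r : ℝ => g (r ^ 2)) (deriv g (r ^ 2) * (2 * r)) r :=
      ((hg.differentiable (by simp) (r ^ 2)).hasDerivAt).comp r hsq
    have h2 : HasDerivAt (fun r : ℝ => deriv g (r ^ 2))
        (deriv (deriv g) (r ^ 2) * (2 * r)) r :=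
      HasDerivAt.comp (h₂ := deriv g) r (hg'.differentiable (by simp) (r ^ 2)).hasDerivAt hsq
    refine HasDerivAt.deriv ((((hsq.const_mul 8).mul h2).add (h1.const_mul 4)).congr_deriv ?_)
    ring
  have h := HasCompactSupport.integral_Ioi_deriv_eq (hAc.of_le (by simp)) hAs 0
  simp_rw [hd] at h
  rw [h]
  simp [hA]

theorem IsNormalizing.mul_pi {c : ℝ} (h : IsNormalizing c) : c * Real.pi = 1 / 2 := by
  set g : ℝ → ℝ := fun n => Real.smoothTransition (2 - n)
  have hg : ContDiff ℝ (⊤ : ℕ∞) g :=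
    Real.smoothTransition.contDiff.comp (contDiff_const.sub contDiff_id)
  have hg0 : g 0 = 1 := Real.smoothTransition.one_of_one_le (by norm_num)
  have hgv : ∀ n, 2 < n → g n = 0 := fun n hn =>
    Real.smoothTransition.zero_of_nonpos (by linarith)
  have hg' : ContDiff ℝ (⊤ : ℕ∞) (deriv g) := (contDiff_infty_iff_deriv.1 hg).2
  have hg'' : ContDiff ℝ (⊤ : ℕ∞) (deriv (deriv g)) := (contDiff_infty_iff_deriv.1 hg').2
  have hgv' : ∀ n, 2 < n → deriv g n = 0 := fun n hn => deriv_eq_zero_of_vanishing hgv hn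
  have hsupp : HasCompactSupport fun y => g (gauge4 y) := by
    have hK := (isCompact_Icc (a := (-2 : ℝ)) (b := 2)).prod
      ((isCompact_Icc (a := (-2 : ℝ)) (b := 2)).prod (isCompact_Icc (a := (-2 : ℝ)) (b := 2)))
    refine HasCompactSupport.intro' hK hK.isClosed fun y hy => hgv _ ?_
    by_contra! hle
    rw [gauge4] at hle
    refine hy ⟨abs_le.1 ?_, abs_le.1 ?_, abs_le.1 ?_⟩ <;>
      refine abs_le_of_sq_le_sq ?_ (by norm_num) <;>
      nlinarith [sq_nonneg y.1, sq_nonneg y.2.1, sq_nonneg y.2.2,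
        sq_nonneg (y.1 ^ 2 + y.2.1 ^ 2 - 2)]
  have hmain := h (fun y => g (gauge4 y)) (hg.comp contDiff_gauge4) hsupp
  have hpt : ∀ y, Gam c 0 y * subLap (fun y => g (gauge4 y)) y =
      c * ((y.1 ^ 2 + y.2.1 ^ 2) * gauge4 y ^ (-(1 : ℝ) / 2) *
        (fun n => 24 * deriv g n + 16 * n * deriv (deriv g) n) (gauge4 y)) := by
    intro y
    have hG : Gam c 0 y = c * gauge4 y ^ (-(1 : ℝ) / 2) := by
      simp [Gam, gauge4]
    rw [hG, subLap_comp_gauge4 hg]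
    ring
  simp_rw [hpt] at hmain
  have hcont : Continuous fun n => 24 * deriv g n + 16 * n * deriv (deriv g) n :=
    (continuous_const.mul hg'.continuous).add
      ((continuous_const.mul continuous_id).mul hg''.continuous)
  rw [integral_const_mul, integral_gauge4_weighted hcont
    (fun n hn => by rw [hgv' n hn, deriv_eq_zero_of_vanishing hgv' hn]; ring),
    integral_radial_profile hg hgv] at hmain
  have : gauge4 0 = 0 := by simp [gauge4]
  rw [this, hg0] at hmain
  linarith

/-- The kernel `k₁ + k` in the coordinates `u = x₂ - y₂`, `v = x₃ - y₃ + y₂ x₁ / 2`. -/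
def shearedKernel (c s : ℝ) (p : ℝ × ℝ) : ℝ :=
  (2 * c * (s ^ 2 + p.1 ^ 2) * s + 8 * c * p.1 * p.2) *
    ((s ^ 2 + p.1 ^ 2) ^ 2 + 16 * p.2 ^ 2) ^ (-(3 : ℝ) / 2)

/-- The inverse of the change of coordinates `ŷ ↦ (u, v)`. -/
def shear (x : ℝ × ℝ × ℝ) (p : ℝ × ℝ) : ℝ × ℝ :=
  (x.2.1 - p.1, x.2.2 + (1 / 2) * (x.2.1 - p.1) * x.1 - p.2)

theorem k1_add_kker_shear (c : ℝ) (x : ℝ × ℝ × ℝ) (p : ℝ × ℝ) :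
    k1 c x (shear x p) + kker c x (shear x p) = shearedKernel c x.1 p := by
  have h : Dden x (shear x p) = (x.1 ^ 2 + p.1 ^ 2) ^ 2 + 16 * p.2 ^ 2 := by
    simp only [Dden, shear]; ring
  simp only [k1, kker, shearedKernel, h]
  simp only [shear]
  ring

theorem measurePreserving_shear (x : ℝ × ℝ × ℝ) : MeasurePreserving (shear x) := by
  refine MeasurePreserving.skew_product (f := fun u : ℝ => x.2.1 - u)
    (g := fun u v : ℝ => x.2.2 + (1 / 2) * (x.2.1 - u) * x.1 - v)
    (Measure.measurePreserving_sub_left volume x.2.1) ?_ ?_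
  · unfold Function.uncurry; fun_prop
  · exact ae_of_all _ fun u => (Measure.measurePreserving_sub_left volume _).map_eq

theorem mem_bhat_iff {R : ℝ} (hR : 0 < R) (a b : ℝ × ℝ) :
    b ∈ bhat R a ↔ (a.1 - b.1) ^ 4 + 16 * (a.2 - b.2) ^ 2 < R ^ 4 := by
  have h0 : 0 ≤ (a.1 - b.1) ^ 4 + 16 * (a.2 - b.2) ^ 2 := by positivity
  simp only [bhat, dt, Set.mem_ofPred_eq]
  rw [one_div, Real.rpow_inv_lt_iff_of_pos h0 hR.le (by norm_num)]
  norm_cast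

theorem isOpen_bhat {R : ℝ} (hR : 0 < R) (a : ℝ × ℝ) : IsOpen (bhat R a) := by
  have : bhat R a = {b | (a.1 - b.1) ^ 4 + 16 * (a.2 - b.2) ^ 2 < R ^ 4} :=
    Set.ext fun b => mem_bhat_iff hR a b
  rw [this]
  exact isOpen_lt (by fun_prop) (by fun_prop)

theorem abs_le_of_pow_four_add_sq_lt {R u v : ℝ} (hR : 0 < R)
    (h : u ^ 4 + 16 * v ^ 2 < R ^ 4) : |u| ≤ R ∧ |v| ≤ R ^ 2 := by
  constructor
  · refine (pow_le_pow_iff_left₀ (abs_nonneg u) hR.le (n := 4) (by norm_num)).1 ?_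
    rw [Even.pow_abs (by decide)]
    nlinarith [sq_nonneg v]
  · refine abs_le_of_sq_le_sq ?_ (by positivity)
    nlinarith [sq_nonneg v, sq_nonneg (u ^ 2)]

theorem continuous_shearedKernel (c : ℝ) {s : ℝ} (hs : 0 < s) :
    Continuous (shearedKernel c s) := by
  unfold shearedKernel
  refine Continuous.mul (by fun_prop) (Continuous.rpow_const (by fun_prop) fun p => Or.inl ?_)
  positivity

theorem continuous_k1_add_kker (c : ℝ) {x : ℝ × ℝ × ℝ} (hx : 0 < x.1) :
    Continuous fun y => k1 c x y + kker c x y := by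
  have hD : Continuous fun y => Dden x y ^ (-(3 : ℝ) / 2) := by
    unfold Dden
    refine Continuous.rpow_const (by fun_prop) fun p => Or.inl ?_
    positivity
  unfold k1 kker
  fun_prop

theorem integrableOn_k1_add_kker (c : ℝ) {x : ℝ × ℝ × ℝ} (hx : 0 < x.1) (x0 : ℝ × ℝ) {R : ℝ}
    (hR : 0 < R) : IntegrableOn (fun y => k1 c x y + kker c x y) (bhat R x0) := by
  refine ((continuous_k1_add_kker c hx).continuousOn.integrableOn_compact
    (isCompact_Icc (a := x0.1 - R) (b := x0.1 + R) |>.prod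
      (isCompact_Icc (a := x0.2 - R ^ 2) (b := x0.2 + R ^ 2)))).mono_set ?_
  intro y hy
  obtain ⟨h1, h2⟩ := abs_le_of_pow_four_add_sq_lt hR ((mem_bhat_iff hR x0 y).1 hy)
  rw [abs_le] at h1 h2
  exact ⟨⟨by linarith, by linarith⟩, ⟨by linarith, by linarith⟩⟩

theorem setIntegral_bhat_eq (c : ℝ) {x : ℝ × ℝ × ℝ} (hx : 0 < x.1) (x0 : ℝ × ℝ) {R : ℝ}
    (hR : 0 < R) : ∫ y in bhat R x0, (k1 c x y + kker c x y) =
      ∫ p in shear x ⁻¹' bhat R x0, shearedKernel c x.1 p := by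
  have hT := measurePreserving_shear x
  rw [← hT.map_eq, setIntegral_map (isOpen_bhat hR x0).measurableSet
    (continuous_k1_add_kker c hx).aestronglyMeasurable hT.measurable.aemeasurable]
  simp only [k1_add_kker_shear, hT.map_eq]

theorem hasDerivAt_shearedKernel_primitive (c u v : ℝ) {s : ℝ} (hs : 0 < s) :
    HasDerivAt (fun v => (2 * c * s * v / (s ^ 2 + u ^ 2) - c * u / 2) *
      ((s ^ 2 + u ^ 2) ^ 2 + 16 * v ^ 2) ^ (-(1 : ℝ) / 2)) (shearedKernel c s (u, v)) v := by
  have ha : 0 < s ^ 2 + u ^ 2 := by positivity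
  have hD : 0 < (s ^ 2 + u ^ 2) ^ 2 + 16 * v ^ 2 := by positivity
  have h1 : HasDerivAt (fun v : ℝ => (s ^ 2 + u ^ 2) ^ 2 + 16 * v ^ 2) (32 * v) v :=
    (((hasDerivAt_pow 2 v).const_mul 16).const_add ((s ^ 2 + u ^ 2) ^ 2)).congr_deriv
      (by norm_num; ring)
  have h2 := h1.rpow_const (p := -(1 : ℝ) / 2) (Or.inl hD.ne')
  have h3 : HasDerivAt (fun v : ℝ => 2 * c * s * v / (s ^ 2 + u ^ 2) - c * u / 2)
      (2 * c * s / (s ^ 2 + u ^ 2)) v :=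
    ((((hasDerivAt_id v).const_mul (2 * c * s)).div_const (s ^ 2 + u ^ 2)).sub_const
      (c * u / 2)).congr_deriv (by ring)
  refine (h3.mul h2).congr_deriv ?_
  have e : ((s ^ 2 + u ^ 2) ^ 2 + 16 * v ^ 2) ^ (-(1 : ℝ) / 2) =
      ((s ^ 2 + u ^ 2) ^ 2 + 16 * v ^ 2) *
        ((s ^ 2 + u ^ 2) ^ 2 + 16 * v ^ 2) ^ (-(3 : ℝ) / 2) := by
    rw [← Real.rpow_one_add' hD.le (by norm_num)]; norm_num
  rw [e, show (-(1 : ℝ) / 2 - 1) = -(3 : ℝ) / 2 by norm_num]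
  simp only [shearedKernel]
  field_simp
  ring

theorem setIntegral_box_shearedKernel (c δ : ℝ) {s ε : ℝ} (hs : 0 < s) (hδ : 0 ≤ δ)
    (hε : 0 ≤ ε) :
    ∫ p in Set.Icc (-δ) δ ×ˢ Set.Icc (-ε) ε, shearedKernel c s p =
      c * ∫ u in (-δ)..δ, s / (s ^ 2 + u ^ 2) *
        (4 * ε * ((s ^ 2 + u ^ 2) ^ 2 + 16 * ε ^ 2) ^ (-(1 : ℝ) / 2)) := by
  rw [Measure.volume_eq_prod, setIntegral_prod _
    ((continuous_shearedKernel c hs).continuousOn.integrableOn_compact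
      (isCompact_Icc.prod isCompact_Icc)), integral_Icc_eq_integral_Ioc,
    ← intervalIntegral.integral_of_le (by linarith), ← intervalIntegral.integral_const_mul]
  refine intervalIntegral.integral_congr fun u _ => ?_
  rw [integral_Icc_eq_integral_Ioc, ← intervalIntegral.integral_of_le (by linarith),
    intervalIntegral.integral_eq_sub_of_hasDerivAt
      (fun v _ => hasDerivAt_shearedKernel_primitive c u v hs)
      (((continuous_shearedKernel c hs).comp
        (by fun_prop : Continuous fun v : ℝ => (u, v))).intervalIntegrable _ _), neg_sq]
  ring

theorem integral_poisson (δ : ℝ) {s : ℝ} (hs : 0 < s) :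
    ∫ u in (-δ)..δ, s / (s ^ 2 + u ^ 2) = 2 * Real.arctan (δ / s) := by
  have hd : ∀ u : ℝ, HasDerivAt (fun u => Real.arctan (u / s)) (s / (s ^ 2 + u ^ 2)) u := fun u =>
    ((hasDerivAt_id u).div_const s).arctan.congr_deriv (by simp only [id]; field_simp)
  rw [intervalIntegral.integral_eq_sub_of_hasDerivAt (fun u _ => hd u)
    (Continuous.intervalIntegrable (Continuous.div (by fun_prop) (by fun_prop)
      fun u => by positivity) _ _), neg_div, Real.arctan_neg]
  ring

theorem tendsto_setIntegral_box (c : ℝ) {δ ε : ℝ} (hδ : 0 < δ) (hε : 0 < ε) :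
    Tendsto (fun s => ∫ p in Set.Icc (-δ) δ ×ˢ Set.Icc (-ε) ε, shearedKernel c s p)
      (nhdsWithin 0 (Set.Ioi 0)) (nhds (c * Real.pi)) := by
  have harctan : Tendsto (fun s : ℝ => 2 * Real.arctan (δ / s)) (nhdsWithin 0 (Set.Ioi 0))
      (nhds Real.pi) := by
    have h1 : Tendsto (fun s : ℝ => δ / s) (nhdsWithin 0 (Set.Ioi 0)) atTop := by
      simpa [div_eq_mul_inv] using tendsto_inv_nhdsGT_zero.const_mul_atTop hδ
    have h2 := ((Real.tendsto_arctan_atTop.mono_right nhdsWithin_le_nhds).comp h1).const_mul 2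
    rwa [mul_div_cancel₀ Real.pi two_ne_zero] at h2
  have hlow : Tendsto (fun s : ℝ => 2 * Real.arctan (δ / s) - s * (2 * δ / (4 * ε)))
      (nhdsWithin 0 (Set.Ioi 0)) (nhds Real.pi) := by
    have h1 : Tendsto (fun s : ℝ => s * (2 * δ / (4 * ε))) (nhdsWithin 0 (Set.Ioi 0))
        (nhds 0) := by
      have : Continuous fun s : ℝ => s * (2 * δ / (4 * ε)) := by fun_prop
      simpa using (this.tendsto 0).mono_left nhdsWithin_le_nhds
    simpa using harctan.sub h1
  have hfactor : ∀ s u : ℝ, 0 < s →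
      1 - (s ^ 2 + u ^ 2) / (4 * ε) ≤
        4 * ε * ((s ^ 2 + u ^ 2) ^ 2 + 16 * ε ^ 2) ^ (-(1 : ℝ) / 2) ∧
      4 * ε * ((s ^ 2 + u ^ 2) ^ 2 + 16 * ε ^ 2) ^ (-(1 : ℝ) / 2) ≤ 1 := by
    intro s u hs
    have ha : 0 < s ^ 2 + u ^ 2 := by positivity
    generalize s ^ 2 + u ^ 2 = a at ha
    have hD : 0 < a ^ 2 + 16 * ε ^ 2 := by positivity
    rw [neg_div, Real.rpow_neg hD.le, ← Real.sqrt_eq_rpow]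
    have hq : 0 < √(a ^ 2 + 16 * ε ^ 2) := Real.sqrt_pos.2 hD
    have hq1 : √(a ^ 2 + 16 * ε ^ 2) ≤ a + 4 * ε :=
      Real.sqrt_le_iff.2 ⟨by positivity, by nlinarith [mul_pos ha hε]⟩
    have hq2 : 4 * ε ≤ √(a ^ 2 + 16 * ε ^ 2) := Real.le_sqrt_of_sq_le (by nlinarith)
    generalize √(a ^ 2 + 16 * ε ^ 2) = q at *
    constructor
    · rw [← div_eq_mul_inv, le_div_iff₀ hq, ← sub_nonneg]
      have : 4 * ε - (1 - a / (4 * ε)) * q = (4 * ε - q) + a * q / (4 * ε) := by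
        field_simp
        ring
      have h3 : a ≤ a * q / (4 * ε) := by
        rw [le_div_iff₀ (by positivity)]
        exact mul_le_mul_of_nonneg_left hq2 ha.le
      linarith
    · rw [← div_eq_mul_inv, div_le_one hq]
      exact hq2
  have hcont : ∀ s : ℝ, 0 < s → Continuous fun u : ℝ => s / (s ^ 2 + u ^ 2) := fun s hs =>
    Continuous.div (by fun_prop) (by fun_prop) fun u => by positivity
  have hcont' : ∀ s : ℝ, 0 < s → Continuous fun u : ℝ => s / (s ^ 2 + u ^ 2) *
      (4 * ε * ((s ^ 2 + u ^ 2) ^ 2 + 16 * ε ^ 2) ^ (-(1 : ℝ) / 2)) := fun s hs =>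
    (hcont s hs).mul (continuous_const.mul
      (Continuous.rpow_const (by fun_prop) fun u => Or.inl (by positivity)))
  have hmain := tendsto_of_tendsto_of_tendsto_of_le_of_le' hlow harctan
    (f := fun s : ℝ => ∫ u in (-δ)..δ, s / (s ^ 2 + u ^ 2) *
        (4 * ε * ((s ^ 2 + u ^ 2) ^ 2 + 16 * ε ^ 2) ^ (-(1 : ℝ) / 2))) ?_ ?_
  · refine (hmain.const_mul c).congr' ?_
    filter_upwards [self_mem_nhdsWithin] with s hs
    exact (setIntegral_box_shearedKernel c δ hs hδ.le hε.le).symm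
  · filter_upwards [self_mem_nhdsWithin] with s hs
    have hs : 0 < s := hs
    have : ∫ u in (-δ)..δ, (s / (s ^ 2 + u ^ 2) - s / (4 * ε)) =
        2 * Real.arctan (δ / s) - s * (2 * δ / (4 * ε)) := by
      rw [intervalIntegral.integral_sub ((hcont s hs).intervalIntegrable _ _)
        (intervalIntegrable_const), integral_poisson δ hs, intervalIntegral.integral_const,
        smul_eq_mul]
      ring
    rw [← this]
    refine intervalIntegral.integral_mono_on (by linarith)
      (((hcont s hs).sub continuous_const).intervalIntegrable _ _)
      ((hcont' s hs).intervalIntegrable _ _) fun u _ => ?_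
    refine le_trans (le_of_eq ?_) (mul_le_mul_of_nonneg_left (hfactor s u hs).1
      (by positivity : 0 ≤ s / (s ^ 2 + u ^ 2)))
    field_simp
  · filter_upwards [self_mem_nhdsWithin] with s hs
    have hs : 0 < s := hs
    rw [← integral_poisson δ hs]
    refine intervalIntegral.integral_mono_on (by linarith)
      ((hcont' s hs).intervalIntegrable _ _) ((hcont s hs).intervalIntegrable _ _) fun u _ => ?_
    exact mul_le_of_le_one_right (by positivity) (hfactor s u hs).2

theorem shear_mem_bhat_iff {R : ℝ} (hR : 0 < R) (x : ℝ × ℝ × ℝ) (x0 p : ℝ × ℝ) :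
    p ∈ shear x ⁻¹' bhat R x0 ↔
      (x0.1 - (x.2.1 - p.1)) ^ 4 +
        16 * (x0.2 - (x.2.2 + (1 / 2) * (x.2.1 - p.1) * x.1 - p.2)) ^ 2 < R ^ 4 :=
  mem_bhat_iff hR x0 (shear x p)

theorem eventually_shear_preimage_subset (x0 : ℝ × ℝ) {R : ℝ} (hR : 0 < R) :
    ∃ M > 0, ∀ᶠ x : ℝ × ℝ × ℝ in nhds ((0 : ℝ), x0.1, x0.2),
      |x.1| ≤ 1 ∧ shear x ⁻¹' bhat R x0 ⊆ Set.Icc (-M) M ×ˢ Set.Icc (-M) M := by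
  refine ⟨(R + 1) + (R ^ 2 + 1 + (|x0.1| + 1 + (R + 1))), by positivity, ?_⟩
  have h1 : ∀ᶠ x : ℝ × ℝ × ℝ in nhds ((0 : ℝ), x0.1, x0.2), |x.1| < 1 :=
    (by fun_prop : Continuous fun x : ℝ × ℝ × ℝ => |x.1|).tendsto _ |>.eventually_lt_const
      (by simp)
  have h2 : ∀ᶠ x : ℝ × ℝ × ℝ in nhds ((0 : ℝ), x0.1, x0.2), |x.2.1 - x0.1| < 1 :=
    (by fun_prop : Continuous fun x : ℝ × ℝ × ℝ => |x.2.1 - x0.1|).tendsto _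
      |>.eventually_lt_const (by simp)
  have h3 : ∀ᶠ x : ℝ × ℝ × ℝ in nhds ((0 : ℝ), x0.1, x0.2), |x.2.2 - x0.2| < 1 :=
    (by fun_prop : Continuous fun x : ℝ × ℝ × ℝ => |x.2.2 - x0.2|).tendsto _
      |>.eventually_lt_const (by simp)
  filter_upwards [h1, h2, h3] with x h1 h2 h3
  refine ⟨h1.le, fun p hp => ?_⟩
  obtain ⟨ha, hb⟩ := abs_le_of_pow_four_add_sq_lt hR ((shear_mem_bhat_iff hR x x0 p).1 hp)
  have hu : |p.1| ≤ R + 1 := by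
    rw [abs_le] at *
    rw [abs_lt] at h2
    constructor <;> linarith
  have hw : |x.2.1 - p.1| ≤ |x0.1| + 1 + (R + 1) := by
    calc |x.2.1 - p.1| = |(x0.1 + (x.2.1 - x0.1)) - p.1| := by ring_nf
      _ ≤ |x0.1 + (x.2.1 - x0.1)| + |p.1| := abs_sub _ _
      _ ≤ |x0.1| + |x.2.1 - x0.1| + |p.1| := by gcongr; exact abs_add_le _ _
      _ ≤ _ := by linarith
  have hm : |(1 / 2) * (x.2.1 - p.1) * x.1| ≤ |x0.1| + 1 + (R + 1) := by
    rw [abs_mul, abs_mul]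
    have : |(1 / 2 : ℝ)| = 1 / 2 := abs_of_pos (by norm_num)
    rw [this]
    have := mul_le_mul hw h1.le (abs_nonneg _) (by positivity)
    nlinarith [mul_nonneg (abs_nonneg (x.2.1 - p.1)) (abs_nonneg x.1)]
  have hv : |p.2| ≤ R ^ 2 + 1 + (|x0.1| + 1 + (R + 1)) := by
    rw [abs_le] at hb hm ⊢
    rw [abs_lt] at h3
    constructor <;> linarith
  have hx0 := abs_nonneg x0.1
  have hR2 := sq_nonneg R
  rw [abs_le] at hu hv
  exact ⟨⟨by linarith, by linarith⟩, ⟨by linarith, by linarith⟩⟩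

theorem volume_quasisphere (R : ℝ) :
    volume {p : ℝ × ℝ | p.1 ^ 4 + 16 * p.2 ^ 2 = R} = 0 := by
  rw [Measure.volume_eq_prod]
  refine Measure.measure_prod_null_of_ae_null
    (isClosed_eq (by fun_prop) (by fun_prop)).measurableSet (ae_of_all _ fun u => ?_)
  refine (Set.Finite.subset (Set.toFinite {√((R - u ^ 4) / 16), -√((R - u ^ 4) / 16)})
    fun v hv => ?_).measure_zero _
  have hv : u ^ 4 + 16 * v ^ 2 = R := hv
  have : (R - u ^ 4) / 16 = v ^ 2 := by linarith
  rw [this, Real.sqrt_sq_eq_abs]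
  rcases abs_choice v with h | h <;> simp [h]

theorem le_of_notMem_box {δ ε s : ℝ} (hδ : 0 < δ) (hε : 0 < ε) {p : ℝ × ℝ}
    (hp : p ∉ Set.Icc (-δ) δ ×ˢ Set.Icc (-ε) ε) :
    min (δ ^ 4) (16 * ε ^ 2) ≤ (s ^ 2 + p.1 ^ 2) ^ 2 + 16 * p.2 ^ 2 := by
  rw [Set.mem_prod, Set.mem_Icc, Set.mem_Icc, ← abs_le, ← abs_le, not_and_or, not_le,
    not_le] at hp
  rcases hp with h | h
  · refine (min_le_left _ _).trans ?_
    have h1 : δ ^ 2 ≤ p.1 ^ 2 := by rw [← sq_abs p.1]; gcongr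
    nlinarith [sq_nonneg s, sq_nonneg p.2, sq_nonneg δ]
  · refine (min_le_right _ _).trans ?_
    have h1 : ε ^ 2 ≤ p.2 ^ 2 := by rw [← sq_abs p.2]; gcongr
    nlinarith [sq_nonneg (s ^ 2 + p.1 ^ 2)]

theorem abs_shearedKernel_le {c s M m : ℝ} (hc : 0 < c) (hm : 0 < m) {p : ℝ × ℝ}
    (hs : |s| ≤ 1) (h1 : |p.1| ≤ M) (h2 : |p.2| ≤ M)
    (hD : m ≤ (s ^ 2 + p.1 ^ 2) ^ 2 + 16 * p.2 ^ 2) :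
    |shearedKernel c s p| ≤
      (2 * c * (1 ^ 2 + M ^ 2) * 1 + 8 * c * M * M) * m ^ (-(3 : ℝ) / 2) := by
  have hM : 0 ≤ M := (abs_nonneg _).trans h1
  rw [shearedKernel, abs_mul]
  refine mul_le_mul ?_ ?_ (abs_nonneg _) (by positivity)
  · refine (abs_add_le _ _).trans ?_
    rw [abs_mul _ s, abs_mul (2 * c), abs_mul _ p.2, abs_mul (8 * c),
      abs_of_pos (by positivity : 0 < 2 * c),
      abs_of_pos (by positivity : 0 < 8 * c), abs_of_nonneg (by positivity : 0 ≤ s ^ 2 + p.1 ^ 2),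
      ← sq_abs s, ← sq_abs p.1]
    gcongr
  · rw [abs_of_nonneg (by positivity)]
    exact Real.rpow_le_rpow_of_nonpos hm hD (by norm_num)

theorem integral_eq_zero_of_odd_snd {f : ℝ × ℝ → ℝ} (hf : ∀ u v, f (u, -v) = -f (u, v)) :
    ∫ p, f p = 0 := by
  have h := ((MeasurePreserving.id (volume : Measure ℝ)).prod
    (Measure.measurePreserving_neg (volume : Measure ℝ))).integral_comp
    (((Homeomorph.refl ℝ).prodCongr (Homeomorph.neg ℝ)).measurableEmbedding) f
  rw [← Measure.volume_eq_prod] at h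
  have h2 : ∫ p, f (Prod.map id Neg.neg p) = -∫ p, f p := by
    rw [← integral_neg]
    exact integral_congr_ae (ae_of_all _ fun p => hf p.1 p.2)
  have h3 := h2.symm.trans h
  linarith

theorem tendsto_setIntegral_diff_box {c : ℝ} (hc : 0 < c) (x0 : ℝ × ℝ) {R δ ε : ℝ}
    (hR : 0 < R) (hδ : 0 < δ) (hε : 0 < ε) :
    Tendsto (fun x : ℝ × ℝ × ℝ =>
      ∫ p in shear x ⁻¹' bhat R x0 \ (Set.Icc (-δ) δ ×ˢ Set.Icc (-ε) ε), shearedKernel c x.1 p)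
      (nhdsWithin ((0 : ℝ), x0.1, x0.2) {x : ℝ × ℝ × ℝ | 0 < x.1}) (nhds 0) := by
  set box : Set (ℝ × ℝ) := Set.Icc (-δ) δ ×ˢ Set.Icc (-ε) ε with hbox
  have hboxm : MeasurableSet box := measurableSet_Icc.prod measurableSet_Icc
  have hA : ∀ x, MeasurableSet (shear x ⁻¹' bhat R x0 \ box) := fun x =>
    ((measurePreserving_shear x).measurable (isOpen_bhat hR x0).measurableSet).diff hboxm
  obtain ⟨M, hM, hsub⟩ := eventually_shear_preimage_subset x0 hR
  have hm : 0 < min (δ ^ 4) (16 * ε ^ 2) := by positivity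
  set m := min (δ ^ 4) (16 * ε ^ 2)
  have hzero : ∫ p, (shear (0, x0.1, x0.2) ⁻¹' bhat R x0 \ box).indicator
      (shearedKernel c 0) p = 0 := by
    refine integral_eq_zero_of_odd_snd fun u v => ?_
    have hmem : (u, -v) ∈ shear (0, x0.1, x0.2) ⁻¹' bhat R x0 \ box ↔
        (u, v) ∈ shear (0, x0.1, x0.2) ⁻¹' bhat R x0 \ box := by
      rw [Set.mem_sdiff, Set.mem_sdiff, shear_mem_bhat_iff hR, shear_mem_bhat_iff hR]
      refine and_congr (by ring_nf) (not_congr ?_)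
      simp only [hbox, Set.mem_prod, Set.mem_Icc, ← abs_le, abs_neg]
    have hodd : shearedKernel c 0 (u, -v) = -shearedKernel c 0 (u, v) := by
      simp only [shearedKernel, neg_sq]
      ring
    by_cases h : (u, v) ∈ shear (0, x0.1, x0.2) ⁻¹' bhat R x0 \ box
    · rw [Set.indicator_of_mem h, Set.indicator_of_mem (hmem.2 h), hodd]
    · rw [Set.indicator_of_notMem h, Set.indicator_of_notMem (mt hmem.1 h), neg_zero]
  suffices h : Tendsto (fun x : ℝ × ℝ × ℝ =>
      ∫ p, (shear x ⁻¹' bhat R x0 \ box).indicator (shearedKernel c x.1) p)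
      (nhdsWithin ((0 : ℝ), x0.1, x0.2) {x : ℝ × ℝ × ℝ | 0 < x.1})
      (nhds (∫ p, (shear (0, x0.1, x0.2) ⁻¹' bhat R x0 \ box).indicator
        (shearedKernel c 0) p)) by
    simpa only [hzero, integral_indicator (hA _)] using h
  refine tendsto_integral_filter_of_dominated_convergence
    ((Set.Icc (-M) M ×ˢ Set.Icc (-M) M).indicator fun _ =>
      (2 * c * (1 ^ 2 + M ^ 2) * 1 + 8 * c * M * M) * m ^ (-(3 : ℝ) / 2)) ?_ ?_ ?_ ?_
  · filter_upwards [self_mem_nhdsWithin] with x hx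
    exact ((continuous_shearedKernel c hx).measurable.indicator (hA x)).aestronglyMeasurable
  · filter_upwards [nhdsWithin_le_nhds hsub] with x ⟨hx1, hx2⟩
    refine ae_of_all _ fun p => ?_
    by_cases hp : p ∈ shear x ⁻¹' bhat R x0 \ box
    · have hp2 := hx2 hp.1
      rw [Set.indicator_of_mem hp, Set.indicator_of_mem hp2]
      exact abs_shearedKernel_le hc hm hx1 (abs_le.2 hp2.1) (abs_le.2 hp2.2)
        (le_of_notMem_box hδ hε hp.2)
    · rw [Set.indicator_of_notMem hp, norm_zero]
      exact Set.indicator_nonneg (fun _ _ => by positivity) _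
  · rw [integrable_indicator_iff (measurableSet_Icc.prod measurableSet_Icc)]
    exact continuousOn_const.integrableOn_compact (isCompact_Icc.prod isCompact_Icc)
  · have hae : ∀ᵐ p : ℝ × ℝ, ¬ (p.1 ^ 4 + 16 * p.2 ^ 2 = R ^ 4) :=
      (measure_eq_zero_iff_ae_notMem).1 (volume_quasisphere (R ^ 4))
    filter_upwards [hae] with p hp
    by_cases hpb : p ∈ box
    · have hn : ∀ x, p ∉ shear x ⁻¹' bhat R x0 \ box := fun x h => h.2 hpb
      simp only [Set.indicator_of_notMem (hn _)]
      exact tendsto_const_nhds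
    have hQ : Tendsto (fun x : ℝ × ℝ × ℝ => (x0.1 - (x.2.1 - p.1)) ^ 4 +
        16 * (x0.2 - (x.2.2 + (1 / 2) * (x.2.1 - p.1) * x.1 - p.2)) ^ 2)
        (nhdsWithin ((0 : ℝ), x0.1, x0.2) {x : ℝ × ℝ × ℝ | 0 < x.1})
        (nhds (p.1 ^ 4 + 16 * p.2 ^ 2)) := by
      refine Tendsto.mono_left ?_ nhdsWithin_le_nhds
      refine Continuous.tendsto' (by fun_prop) _ _ ?_
      simp
    have hmem0 : p ∈ shear (0, x0.1, x0.2) ⁻¹' bhat R x0 ↔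
        p.1 ^ 4 + 16 * p.2 ^ 2 < R ^ 4 := by
      rw [shear_mem_bhat_iff hR]
      simp
    rcases lt_or_gt_of_ne hp with h | h
    · have hmem : p ∈ shear (0, x0.1, x0.2) ⁻¹' bhat R x0 \ box := ⟨hmem0.2 h, hpb⟩
      rw [Set.indicator_of_mem hmem]
      have hcont : ContinuousAt (fun x : ℝ × ℝ × ℝ => shearedKernel c x.1 p)
          ((0 : ℝ), x0.1, x0.2) := by
        unfold shearedKernel
        refine ContinuousAt.mul (by fun_prop) (ContinuousAt.rpow_const (by fun_prop)
          (Or.inl (hm.trans_le ?_).ne'))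
        exact le_of_notMem_box hδ hε hpb
      refine (hcont.tendsto.mono_left nhdsWithin_le_nhds).congr' ?_
      filter_upwards [hQ.eventually_lt_const h] with x hx
      have hmem : p ∈ shear x ⁻¹' bhat R x0 \ box :=
        ⟨(shear_mem_bhat_iff hR x x0 p).2 hx, hpb⟩
      exact (Set.indicator_of_mem hmem _).symm
    · rw [Set.indicator_of_notMem fun h' => (hmem0.1 h'.1).not_gt h]
      refine tendsto_const_nhds.congr' ?_
      filter_upwards [hQ.eventually_const_lt h] with x hx
      exact (Set.indicator_of_notMem
        (fun h' => ((shear_mem_bhat_iff hR x x0 p).1 h'.1).not_gt hx) _).symm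

theorem eventually_box_subset (x0 : ℝ × ℝ) {R δ ε : ℝ} (hR : 0 < R)
    (h : δ ^ 4 + 16 * ε ^ 2 < R ^ 4) :
    ∀ᶠ x : ℝ × ℝ × ℝ in nhds ((0 : ℝ), x0.1, x0.2),
      Set.Icc (-δ) δ ×ˢ Set.Icc (-ε) ε ⊆ shear x ⁻¹' bhat R x0 := by
  refine (isCompact_Icc.prod isCompact_Icc).eventually_forall_of_forall_eventually
    (P := fun x p => p ∈ shear x ⁻¹' bhat R x0) fun p hp => ?_
  simp only [shear_mem_bhat_iff hR]
  refine Tendsto.eventually_lt_const (v := p.1 ^ 4 + 16 * p.2 ^ 2) ?_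
    (Continuous.tendsto' (by fun_prop) _ _ (by simp))
  have h1 : p.1 ^ 4 ≤ δ ^ 4 := by
    rw [← Even.pow_abs (by decide) p.1]
    exact pow_le_pow_left₀ (abs_nonneg _) (abs_le.2 hp.1) 4
  have h2 : p.2 ^ 2 ≤ ε ^ 2 := by
    rw [← sq_abs p.2]
    exact pow_le_pow_left₀ (abs_nonneg _) (abs_le.2 hp.2) 2
  linarith

theorem tendsto_setIntegral_bhat {c : ℝ} (hc : 0 < c) (x0 : ℝ × ℝ) {R : ℝ} (hR : 0 < R) :
    Tendsto (fun x : ℝ × ℝ × ℝ => ∫ y in bhat R x0, (k1 c x y + kker c x y))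
      (nhdsWithin ((0 : ℝ), x0.1, x0.2) {x : ℝ × ℝ × ℝ | 0 < x.1}) (nhds (c * Real.pi)) := by
  have hδ : 0 < R / 2 := by positivity
  have hε : 0 < R ^ 2 / 8 := by positivity
  have hfst : Tendsto (fun x : ℝ × ℝ × ℝ => x.1)
      (nhdsWithin ((0 : ℝ), x0.1, x0.2) {x : ℝ × ℝ × ℝ | 0 < x.1})
      (nhdsWithin 0 (Set.Ioi 0)) :=
    tendsto_nhdsWithin_of_tendsto_nhds_of_eventually_within _
      ((continuous_fst.tendsto _).mono_left nhdsWithin_le_nhds) self_mem_nhdsWithin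
  have hsum := ((tendsto_setIntegral_box c hδ hε).comp hfst).add
    (tendsto_setIntegral_diff_box hc x0 hR hδ hε)
  rw [add_zero] at hsum
  refine hsum.congr' ?_
  obtain ⟨M, hM, hsub⟩ := eventually_shear_preimage_subset x0 hR
  filter_upwards [self_mem_nhdsWithin, nhdsWithin_le_nhds hsub, nhdsWithin_le_nhds
    (eventually_box_subset x0 hR (δ := R / 2) (ε := R ^ 2 / 8)
      (by nlinarith [pow_pos hR 4]))] with x hx hx1 hx2
  rw [setIntegral_bhat_eq c hx x0 hR]
  have hint : IntegrableOn (shearedKernel c x.1) (shear x ⁻¹' bhat R x0) :=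
    ((continuous_shearedKernel c hx).continuousOn.integrableOn_compact
      (isCompact_Icc.prod isCompact_Icc)).mono_set hx1.2
  have := integral_inter_add_sdiff (s := shear x ⁻¹' bhat R x0)
    (measurableSet_Icc.prod measurableSet_Icc : MeasurableSet
      (Set.Icc (-(R / 2)) (R / 2) ×ˢ Set.Icc (-(R ^ 2 / 8)) (R ^ 2 / 8))) hint
  rwa [Set.inter_eq_self_of_subset_right hx2] at this

/-- For `x₁ > 0` the function `ŷ ↦ k₁(x,ŷ) + k(x,ŷ)` is integrable on
`B̂_R(x̂₀)`, and its integral tends to `1/2` as `x → (0, x̂₀)` within `{x₁ > 0}`. -/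
theorem stmt1 (c : ℝ) (hc : 0 < c) (hnorm : IsNormalizing c) (x0 : ℝ × ℝ) (R : ℝ) (hR : 0 < R) :
    (∀ x : ℝ × ℝ × ℝ, 0 < x.1 →
      IntegrableOn (fun y => k1 c x y + kker c x y) (bhat R x0)) ∧
    Tendsto (fun x : ℝ × ℝ × ℝ => ∫ y in bhat R x0, (k1 c x y + kker c x y))
      (nhdsWithin ((0 : ℝ), x0.1, x0.2) {x : ℝ × ℝ × ℝ | 0 < x.1}) (nhds (1 / 2)) := by
  refine ⟨fun x hx => integrableOn_k1_add_kker c hx x0 hR, ?_⟩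
  rw [← hnorm.mul_pi]
  exact tendsto_setIntegral_bhat hc x0 hR
end
end

section
/- Let 0<α<1 and let f:ℝ²→ℝ be bounded. The following are equivalent. (i) The partial derivatives ∂₂f, ∂₂²f and ∂₃f exist everywhere, are continuous and bounded, and the seminorms [∂₂²f]_α and [∂₃f]_α are finite. (ii) There exist C>0 and bounded functions a,b,q,d:ℝ²→ℝ such that for every x̂∈ℝ², every ρ>0 and every ŷ∈B̂_ρ(x̂), |f(ŷ) − (a(x̂) + b(x̂)(y₂−x₂) + q(x̂)(y₂−x₂)² + d(x̂)(y₃−x₃))| ≤ Cρ^{2+α}. Moreover, when (i) holds, (ii) holds with a=f, b=∂₂f, q=(1/2)∂₂²f, d=∂₃f, and conversely in (ii) the coefficients are necessarily a=f, b=∂₂f, q=(1/2)∂₂²f, d=∂₃f. -/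
open MeasureTheory Filter

noncomputable section

/-- Partial derivative `∂₂` (in the first coordinate of the plane `Π ≅ ℝ²`,
which corresponds to `x₂`). -/
def d2 (f : ℝ × ℝ → ℝ) (p : ℝ × ℝ) : ℝ := deriv (fun s => f (s, p.2)) p.1

/-- Partial derivative `∂₃` (in the second coordinate of the plane `Π ≅ ℝ²`,
which corresponds to `x₃`). -/
def d3 (f : ℝ × ℝ → ℝ) (p : ℝ × ℝ) : ℝ := deriv (fun s => f (p.1, s)) p.2

/-- A function is bounded. -/
def Bdd (h : ℝ × ℝ → ℝ) : Prop := ∃ M, ∀ p, |h p| ≤ M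

/-- `f` is of class `C^{2,α}(Π)`: it is bounded, `∂₂f`, `∂₂²f`, `∂₃f` exist everywhere,
are continuous and bounded, and `[∂₂²f]_α`, `[∂₃f]_α` are finite. -/
def C2aClass (α : ℝ) (f : ℝ × ℝ → ℝ) : Prop :=
  Bdd f ∧
  (∀ p : ℝ × ℝ, DifferentiableAt ℝ (fun s => f (s, p.2)) p.1) ∧
  (∀ p : ℝ × ℝ, DifferentiableAt ℝ (fun s => d2 f (s, p.2)) p.1) ∧
  (∀ p : ℝ × ℝ, DifferentiableAt ℝ (fun s => f (p.1, s)) p.2) ∧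
  Continuous (d2 f) ∧ Continuous (d2 (d2 f)) ∧ Continuous (d3 f) ∧
  Bdd (d2 f) ∧ Bdd (d2 (d2 f)) ∧ Bdd (d3 f) ∧
  (∃ M, ∀ p q, |d2 (d2 f) p - d2 (d2 f) q| ≤ M * dt p q ^ α) ∧
  (∃ M, ∀ p q, |d3 f p - d3 f q| ≤ M * dt p q ^ α)

/-- The Campanato/Folland–Stein type polynomial-approximation property (condition (ii)). -/
def PolyApprox (α : ℝ) (f a b q d : ℝ × ℝ → ℝ) (C : ℝ) : Prop :=
  ∀ p : ℝ × ℝ, ∀ ρ > (0 : ℝ), ∀ y ∈ bhat ρ p,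
    |f y - (a p + b p * (y.1 - p.1) + q p * (y.1 - p.1) ^ 2 + d p * (y.2 - p.2))| ≤
      C * ρ ^ (2 + α)

theorem dt_lt_iff {p y : ℝ × ℝ} {ρ : ℝ} (hρ : 0 < ρ) :
    dt p y < ρ ↔ (p.1 - y.1) ^ 4 + 16 * (p.2 - y.2) ^ 2 < ρ ^ 4 := by
  have hρ4 : ρ = (ρ ^ 4) ^ ((1 : ℝ) / 4) := by
    rw [← Real.rpow_natCast, ← Real.rpow_mul hρ.le]; norm_num
  have h0 : 0 ≤ (p.1 - y.1) ^ 4 + 16 * (p.2 - y.2) ^ 2 := by positivity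
  conv_lhs => rw [hρ4]
  exact Real.rpow_lt_rpow_iff h0 (by positivity) (by norm_num)

theorem dt_nonneg (p y : ℝ × ℝ) : 0 ≤ dt p y := by unfold dt; positivity

theorem dt_self (p : ℝ × ℝ) : dt p p = 0 := by simp [dt]

theorem dt_pow_four (p y : ℝ × ℝ) :
    dt p y ^ 4 = (p.1 - y.1) ^ 4 + 16 * (p.2 - y.2) ^ 2 := by
  rw [dt, ← Real.rpow_natCast, ← Real.rpow_mul (by positivity)]; norm_num

theorem abs_fst_sub_le_dt (p y : ℝ × ℝ) : |p.1 - y.1| ≤ dt p y := by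
  refine le_of_pow_le_pow_left₀ (n := 4) (by norm_num) (dt_nonneg p y) ?_
  rw [dt_pow_four, (by decide : Even 4).pow_abs]
  nlinarith [sq_nonneg (p.2 - y.2)]

theorem abs_snd_sub_le_dt_sq (p y : ℝ × ℝ) : |p.2 - y.2| ≤ dt p y ^ 2 := by
  refine le_of_pow_le_pow_left₀ (n := 2) (by norm_num) (by positivity) ?_
  rw [← pow_mul, sq_abs]
  norm_num
  rw [dt_pow_four]
  nlinarith [sq_nonneg (p.2 - y.2), sq_nonneg ((p.1 - y.1) ^ 2)]

theorem eq_of_dt_eq_zero {p y : ℝ × ℝ} (h : dt p y = 0) : p = y := by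
  have h1 := abs_fst_sub_le_dt p y
  have h2 := abs_snd_sub_le_dt_sq p y
  rw [h] at h1 h2
  norm_num at h2
  exact Prod.ext (sub_eq_zero.1 (abs_nonpos_iff.1 h1)) (sub_eq_zero.1 h2)

theorem continuous_dt_left (y : ℝ × ℝ) : Continuous fun p => dt p y := by
  unfold dt
  exact Continuous.rpow_const (by fun_prop) (fun _ => Or.inr (by norm_num))

theorem dt_le_dt_of_abs_le {p y z : ℝ × ℝ} (h1 : |z.1 - p.1| ≤ |y.1 - p.1|)
    (h2 : |z.2 - p.2| ≤ |y.2 - p.2|) : dt z p ≤ dt p y := by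
  unfold dt
  apply Real.rpow_le_rpow (by positivity) _ (by norm_num)
  have e1 : (z.1 - p.1) ^ 4 ≤ (p.1 - y.1) ^ 4 := by
    rw [← (by decide : Even 4).pow_abs, ← (by decide : Even 4).pow_abs (p.1 - y.1),
      abs_sub_comm p.1]
    gcongr
  have e2 : (z.2 - p.2) ^ 2 ≤ (p.2 - y.2) ^ 2 := by
    rw [← sq_abs, ← sq_abs (p.2 - y.2), abs_sub_comm p.2]
    gcongr
  linarith

/-- A real function with a first-order expansion up to an error `O(|y - x| ^ (1 + β))`
is differentiable. -/
theorem hasDerivAt_of_abs_sub_le_rpow {g : ℝ → ℝ} {m x K β : ℝ} (hβ : 0 < β)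
    (h : ∀ y, |g y - g x - m * (y - x)| ≤ K * |y - x| ^ (1 + β)) : HasDerivAt g m x := by
  rw [hasDerivAt_iff_isLittleO]
  have hO : (fun y => g y - g x - (y - x) • m) =O[nhds x] fun y => |y - x| ^ β * (y - x) := by
    refine Asymptotics.IsBigO.of_bound K (Eventually.of_forall fun y => ?_)
    have := h y
    rw [Real.rpow_add' (abs_nonneg _) (by linarith), Real.rpow_one] at this
    rw [Real.norm_eq_abs, norm_mul, Real.norm_eq_abs, Real.norm_eq_abs,
      abs_of_nonneg (Real.rpow_nonneg (abs_nonneg _) _), smul_eq_mul, mul_comm (y - x) m,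
      mul_comm (|y - x| ^ β)]
    exact this
  refine hO.trans_isLittleO ?_
  have ht : Tendsto (fun y => |y - x| ^ β) (nhds x) (nhds 0) := by
    have hc : Continuous fun y => |y - x| ^ β :=
      Continuous.rpow_const (by fun_prop) (fun _ => Or.inr hβ.le)
    simpa [Real.zero_rpow hβ.ne'] using hc.tendsto x
  simpa using ((Asymptotics.isLittleO_one_iff ℝ).2 ht).mul_isBigO
    (Asymptotics.isBigO_refl (fun y => y - x) (nhds x))

/-- Mean value inequality on the interval between two points. -/
theorem abs_sub_le_of_hasDerivAt {g g' : ℝ → ℝ} {x y B : ℝ}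
    (hg : ∀ z, HasDerivAt g (g' z) z) (hB : ∀ z, |z - x| ≤ |y - x| → |g' z| ≤ B) :
    |g y - g x| ≤ B * |y - x| := by
  refine (convex_closedBall x |y - x|).norm_image_sub_le_of_norm_hasDerivWithin_le
    (f := g) (f' := g') (fun z _ => (hg z).hasDerivWithinAt) (fun z hz => hB z ?_) ?_ ?_
  · simpa [Real.dist_eq] using hz
  · simp
  · simp [Real.dist_eq]

/-- Second-order Taylor estimate with a uniform bound on the oscillation of the second
derivative. -/
theorem abs_sub_taylor_two_le {g g' g'' : ℝ → ℝ} {x y B : ℝ}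
    (hg : ∀ z, HasDerivAt g (g' z) z) (hg' : ∀ z, HasDerivAt g' (g'' z) z)
    (hB : ∀ z, |z - x| ≤ |y - x| → |g'' z - g'' x| ≤ B) :
    |g y - (g x + g' x * (y - x) + g'' x / 2 * (y - x) ^ 2)| ≤ B * |y - x| ^ 2 := by
  have hB0 : 0 ≤ B := (abs_nonneg _).trans (hB x (by simp))
  have h1 : ∀ z, |z - x| ≤ |y - x| → |g' z - g' x - g'' x * (z - x)| ≤ B * |y - x| := by
    intro z hz
    have := abs_sub_le_of_hasDerivAt (g := fun z => g' z - g'' x * (z - x))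
      (g' := fun z => g'' z - g'' x) (x := x) (y := z) (B := B)
      (fun w => by
        simpa [Pi.sub_def] using
          (hg' w).sub (((hasDerivAt_id w).sub_const x).const_mul (g'' x)))
      (fun w hw => hB w (hw.trans hz))
    refine le_trans (le_of_eq ?_) (this.trans (mul_le_mul_of_nonneg_left hz hB0))
    congr 1; ring
  have := abs_sub_le_of_hasDerivAt
    (g := fun z => g z - g' x * (z - x) - g'' x / 2 * (z - x) ^ 2)
    (g' := fun z => g' z - g' x - g'' x * (z - x)) (x := x) (y := y) (B := B * |y - x|)
    (fun w => by
      have e := ((hg w).sub (((hasDerivAt_id w).sub_const x).const_mul (g' x))).sub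
        ((((hasDerivAt_id w).sub_const x).pow 2).const_mul (g'' x / 2))
      refine e.congr_deriv ?_
      simp only [id, Nat.cast_ofNat]
      ring)
    h1
  refine le_trans (le_of_eq ?_) (this.trans (le_of_eq (by ring)))
  congr 1; ring

theorem C2aClass.exists_polyApprox {α : ℝ} (hα : 0 < α) {f : ℝ × ℝ → ℝ} (h : C2aClass α f) :
    ∃ C > (0 : ℝ), PolyApprox α f f (d2 f) (fun p => d2 (d2 f) p / 2) (d3 f) C := by
  obtain ⟨-, hd1, hd2, hd3, -, -, -, -, -, -, ⟨M, hM⟩, ⟨N, hN⟩⟩ := h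
  refine ⟨|M| + |N| + 1, by positivity, ?_⟩
  intro p ρ hρ y hy
  have hy' : dt p y < ρ := hy
  have hρα : ∀ {z : ℝ × ℝ}, dt z p ≤ dt p y → dt z p ^ α ≤ ρ ^ α := fun hz =>
    Real.rpow_le_rpow (dt_nonneg _ _) (hz.trans hy'.le) hα.le
  have hρ0 : 0 ≤ ρ ^ α := by positivity
  have hs : |y.1 - p.1| ≤ ρ := by
    rw [abs_sub_comm]; exact (abs_fst_sub_le_dt p y).trans hy'.le
  have ht : |y.2 - p.2| ≤ ρ ^ 2 := by
    rw [abs_sub_comm]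
    exact (abs_snd_sub_le_dt_sq p y).trans (pow_le_pow_left₀ (dt_nonneg _ _) hy'.le 2)
  have h1 := abs_sub_taylor_two_le (g := fun s => f (s, p.2)) (g' := fun s => d2 f (s, p.2))
    (g'' := fun s => d2 (d2 f) (s, p.2)) (x := p.1) (y := y.1) (B := |M| * ρ ^ α)
    (fun z => (hd1 (z, p.2)).hasDerivAt) (fun z => (hd2 (z, p.2)).hasDerivAt)
    (fun z hz => (hM (z, p.2) p).trans <|
      mul_le_mul (le_abs_self M) (hρα (dt_le_dt_of_abs_le hz (by simp)))
        (Real.rpow_nonneg (dt_nonneg _ _) _) (abs_nonneg M))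
  have h2 := abs_sub_le_of_hasDerivAt (g := fun t => f (y.1, t) - d3 f p * (t - p.2))
    (g' := fun t => d3 f (y.1, t) - d3 f p) (x := p.2) (y := y.2) (B := |N| * ρ ^ α)
    (fun z => by
      simpa [Pi.sub_def, d3] using (hd3 (y.1, z)).hasDerivAt.sub
        (((hasDerivAt_id z).sub_const p.2).const_mul (d3 f p)))
    (fun z hz => (hN (y.1, z) p).trans <|
      mul_le_mul (le_abs_self N) (hρα (dt_le_dt_of_abs_le le_rfl hz))
        (Real.rpow_nonneg (dt_nonneg _ _) _) (abs_nonneg N))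
  have h1' := h1.trans (mul_le_mul_of_nonneg_left (pow_le_pow_left₀ (abs_nonneg _) hs 2)
    (by positivity))
  have h2' := h2.trans (mul_le_mul_of_nonneg_left ht (by positivity))
  have hpow : ρ ^ (2 + α) = ρ ^ 2 * ρ ^ α := by
    rw [Real.rpow_add hρ, Real.rpow_ofNat]
  rw [hpow]
  simp only [Prod.mk.eta] at h1' h2'
  have key := (abs_add_le _ _).trans (add_le_add h1' h2')
  have hpos : 0 ≤ ρ ^ 2 * ρ ^ α := by positivity
  refine le_trans (le_of_eq ?_) (key.trans ?_)
  · congr 1; ring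
  · linarith

section PolyApprox

variable {α C : ℝ} {f a b q d : ℝ × ℝ → ℝ}

theorem PolyApprox.abs_sub_le (h : PolyApprox α f a b q d C) {p y : ℝ × ℝ} {r : ℝ} (hr : 0 < r)
    (h1 : |y.1 - p.1| ≤ 2 * r) (h2 : |y.2 - p.2| ≤ 2 * r ^ 2) :
    |f y - (a p + b p * (y.1 - p.1) + q p * (y.1 - p.1) ^ 2 + d p * (y.2 - p.2))| ≤
      C * 3 ^ (2 + α) * r ^ (2 + α) := by
  have := h p (3 * r) (by positivity) y ((dt_lt_iff (by positivity)).2 ?_)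
  · rwa [Real.mul_rpow (by norm_num) hr.le, ← mul_assoc] at this
  · have e1 : (p.1 - y.1) ^ 4 ≤ (2 * r) ^ 4 := by
      rw [← (by decide : Even 4).pow_abs, abs_sub_comm]
      gcongr
    have e2 : (p.2 - y.2) ^ 2 ≤ (2 * r ^ 2) ^ 2 := by
      rw [← sq_abs, abs_sub_comm]
      gcongr
    have : 0 < r ^ 4 := by positivity
    nlinarith

theorem PolyApprox.eq_self (hα : 0 < α) (h : PolyApprox α f a b q d C) : a = f := by
  funext p
  have hc : Continuous fun r : ℝ => C * 3 ^ (2 + α) * r ^ (2 + α) :=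
    continuous_const.mul (Real.continuous_rpow_const (by linarith))
  have ht : Tendsto (fun r : ℝ => C * 3 ^ (2 + α) * r ^ (2 + α)) (nhdsWithin 0 (Set.Ioi 0))
      (nhds 0) := by
    have := (hc.tendsto 0).mono_left (nhdsWithin_le_nhds (s := Set.Ioi (0 : ℝ)))
    rwa [Real.zero_rpow (by linarith), mul_zero] at this
  have : |f p - a p| ≤ 0 := by
    refine ge_of_tendsto ht ?_
    filter_upwards [self_mem_nhdsWithin] with r hr
    have hr' : 0 < r := hr
    have := h.abs_sub_le (p := p) (y := p) hr' (by simp; positivity) (by simp; positivity)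
    simpa using this
  exact (sub_eq_zero.1 (abs_nonpos_iff.1 this)).symm

theorem PolyApprox.hasDerivAt_fst (hα : 0 < α) (h : PolyApprox α f f b q d C) (p : ℝ × ℝ) :
    HasDerivAt (fun s => f (s, p.2)) (b p) p.1 := by
  have hg : HasDerivAt (fun s => f (s, p.2) - q p * (s - p.1) ^ 2) (b p) p.1 := by
    refine hasDerivAt_of_abs_sub_le_rpow (K := C * 3 ^ (2 + α)) (β := 1 + α) (by linarith)
      fun s => ?_
    rcases eq_or_ne s p.1 with rfl | hs
    · simp [Real.zero_rpow (by linarith : 1 + (1 + α) ≠ 0)]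
    · have hpos : 0 < |s - p.1| := abs_pos.2 (sub_ne_zero.2 hs)
      have := h.abs_sub_le (p := p) (y := (s, p.2)) hpos (by simp; linarith)
        (by simp [sq_nonneg])
      rw [show 1 + (1 + α) = 2 + α by ring]
      refine le_trans (le_of_eq ?_) this
      simp only [Prod.mk.eta]
      congr 1; ring
  have := hg.add ((((hasDerivAt_id p.1).sub_const p.1).pow 2).const_mul (q p))
  simpa [Pi.add_def] using this

theorem PolyApprox.hasDerivAt_snd (hα : 0 < α) (h : PolyApprox α f f b q d C) (p : ℝ × ℝ) :
    HasDerivAt (fun t => f (p.1, t)) (d p) p.2 := by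
  refine hasDerivAt_of_abs_sub_le_rpow (K := C * 3 ^ (2 + α)) (β := α / 2) (by linarith)
    fun t => ?_
  rcases eq_or_ne t p.2 with rfl | ht
  · simp [Real.zero_rpow (by linarith : 1 + α / 2 ≠ 0)]
  · have hpos : 0 < |t - p.2| := abs_pos.2 (sub_ne_zero.2 ht)
    have := h.abs_sub_le (p := p) (y := (p.1, t)) (r := √|t - p.2|) (Real.sqrt_pos.2 hpos)
      (by simp) (by rw [Real.sq_sqrt hpos.le]; simp only; linarith)
    rw [Real.sqrt_eq_rpow, ← Real.rpow_mul hpos.le,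
      show 1 / 2 * (2 + α) = 1 + α / 2 by ring] at this
    refine le_trans (le_of_eq ?_) this
    simp only [Prod.mk.eta]
    congr 1; ring

/-- The approximating polynomials at two points of distance `r` differ by `O(r ^ (2 + α))`,
hence so do their coefficients, each scaled according to its homogeneous degree. -/
theorem PolyApprox.coeff_sub_le (h : PolyApprox α f a b q d C) (p p' : ℝ × ℝ) {r : ℝ}
    (hr : 0 < r) (h1 : |p.1 - p'.1| ≤ r) (h2 : |p.2 - p'.2| ≤ r ^ 2) :
    |q p - q p'| ≤ 4 * (C * 3 ^ (2 + α)) * r ^ α ∧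
    |d p - d p'| ≤ 4 * (C * 3 ^ (2 + α)) * r ^ α ∧
    |b p - b p' - 2 * q p * (p.1 - p'.1)| ≤ 4 * (C * 3 ^ (2 + α)) * r ^ (1 + α) := by
  have hE : ∀ u v : ℝ, |u| ≤ r → |v| ≤ r ^ 2 →
      |(a p + b p * (u - (p.1 - p'.1)) + q p * (u - (p.1 - p'.1)) ^ 2
          + d p * (v - (p.2 - p'.2))) - (a p' + b p' * u + q p' * u ^ 2 + d p' * v)| ≤
        2 * (C * 3 ^ (2 + α) * r ^ (2 + α)) := by
    intro u v hu hv
    have e1 := h.abs_sub_le (p := p) (y := (p'.1 + u, p'.2 + v)) hr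
      (by
        rw [show p'.1 + u - p.1 = u - (p.1 - p'.1) by ring]
        linarith [abs_sub u (p.1 - p'.1)])
      (by
        rw [show p'.2 + v - p.2 = v - (p.2 - p'.2) by ring]
        linarith [abs_sub v (p.2 - p'.2)])
    have e2 := h.abs_sub_le (p := p') (y := (p'.1 + u, p'.2 + v)) hr
      (by simp; linarith) (by simp; linarith [sq_nonneg r])
    refine le_trans (le_of_eq ?_) (((abs_sub _ _).trans (add_le_add e2 e1)).trans
      (le_of_eq (by ring)))
    congr 1; ring
  have hp1 : r ^ (1 + α) = r * r ^ α := by rw [Real.rpow_add hr, Real.rpow_one]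
  have hp2 : r ^ (2 + α) = r ^ 2 * r ^ α := by rw [Real.rpow_add hr, Real.rpow_ofNat]
  rw [hp2] at hE
  rw [hp1]
  set K := C * 3 ^ (2 + α)
  set R := r ^ α
  have E0 := abs_le.1 (hE 0 0 (by simpa using hr.le) (by simp; positivity))
  have E1 := abs_le.1 (hE r 0 (abs_of_pos hr).le (by simp; positivity))
  have E2 := abs_le.1 (hE (-r) 0 (by rw [abs_neg, abs_of_pos hr]) (by simp; positivity))
  have E3 := abs_le.1 (hE 0 (r ^ 2) (by simpa using hr.le) (by rw [abs_of_pos (by positivity)]))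
  have hr2 : 0 < r ^ 2 := by positivity
  refine ⟨?_, ?_, ?_⟩
  · refine le_of_mul_le_mul_left ?_ hr2
    rw [← abs_of_pos hr2, ← abs_mul, abs_of_pos hr2, abs_le]
    constructor <;> linarith [E0.1, E0.2, E1.1, E1.2, E2.1, E2.2]
  · refine le_of_mul_le_mul_left ?_ hr2
    rw [← abs_of_pos hr2, ← abs_mul, abs_of_pos hr2, abs_le]
    constructor <;> linarith [E0.1, E0.2, E3.1, E3.2]
  · have hK : 0 ≤ r ^ 2 * (K * R) := by
      linarith [E0.1, E0.2]
    refine le_of_mul_le_mul_left ?_ hr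
    rw [← abs_of_pos hr, ← abs_mul, abs_of_pos hr, abs_le]
    constructor <;> linarith [E1.1, E1.2, E2.1, E2.2]

theorem PolyApprox.coeff_sub_le_dt (hα : 0 < α) (h : PolyApprox α f a b q d C)
    (p p' : ℝ × ℝ) :
    |q p - q p'| ≤ 4 * (C * 3 ^ (2 + α)) * dt p p' ^ α ∧
    |d p - d p'| ≤ 4 * (C * 3 ^ (2 + α)) * dt p p' ^ α ∧
    |b p - b p' - 2 * q p * (p.1 - p'.1)| ≤ 4 * (C * 3 ^ (2 + α)) * dt p p' ^ (1 + α) := by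
  rcases (dt_nonneg p p').eq_or_lt with h0 | h0
  · obtain rfl := eq_of_dt_eq_zero h0.symm
    simp [dt_self, Real.zero_rpow hα.ne', Real.zero_rpow (by linarith : 1 + α ≠ 0)]
  · exact h.coeff_sub_le p p' h0 (abs_fst_sub_le_dt p p') (abs_snd_sub_le_dt_sq p p')

theorem PolyApprox.hasDerivAt_coeff (hα : 0 < α) (h : PolyApprox α f a b q d C) (p : ℝ × ℝ) :
    HasDerivAt (fun s => b (s, p.2)) (2 * q p) p.1 := by
  refine hasDerivAt_of_abs_sub_le_rpow (K := 12 * (C * 3 ^ (2 + α))) hα fun s => ?_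
  rcases eq_or_ne s p.1 with rfl | hs
  · simp [Real.zero_rpow (by linarith : 1 + α ≠ 0)]
  · have hpos : 0 < |s - p.1| := abs_pos.2 (sub_ne_zero.2 hs)
    obtain ⟨hq, -, hb⟩ := h.coeff_sub_le (s, p.2) p hpos le_rfl (by simp [sq_nonneg])
    have hq' := mul_le_mul_of_nonneg_right hq hpos.le
    rw [Real.rpow_add hpos, Real.rpow_one] at *
    rw [← abs_mul] at hq'
    have e := (abs_add_le (b (s, p.2) - b p - 2 * q (s, p.2) * (s - p.1))
      (2 * ((q (s, p.2) - q p) * (s - p.1)))).trans (add_le_add hb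
        ((abs_mul _ _).trans_le (mul_le_mul_of_nonneg_left hq' (abs_nonneg 2))))
    rw [abs_two] at e
    refine le_trans (le_of_eq ?_) (e.trans (le_of_eq (by ring)))
    simp only [Prod.mk.eta]
    congr 1; ring

theorem continuous_of_abs_sub_le_dt_rpow {g : ℝ × ℝ → ℝ} {M : ℝ} (hα : 0 < α)
    (h : ∀ p p', |g p - g p'| ≤ M * dt p p' ^ α) : Continuous g := by
  refine continuous_iff_continuousAt.2 fun p' => ?_
  rw [ContinuousAt, tendsto_iff_dist_tendsto_zero]
  refine squeeze_zero (fun _ => dist_nonneg) (fun p => h p p') ?_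
  have hc : Continuous fun p => M * dt p p' ^ α :=
    continuous_const.mul ((continuous_dt_left p').rpow_const fun _ => Or.inr hα.le)
  simpa [dt_self, Real.zero_rpow hα.ne'] using hc.tendsto p'

theorem PolyApprox.continuous_coeff (hα : 0 < α) (h : PolyApprox α f a b q d C)
    (hq : Continuous q) : Continuous b := by
  refine continuous_iff_continuousAt.2 fun p' => ?_
  have ht : Tendsto (fun p => b p - b p' - 2 * q p * (p.1 - p'.1)) (nhds p') (nhds 0) := by
    refine squeeze_zero_norm (fun p => (h.coeff_sub_le_dt hα p p').2.2) ?_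
    have hc : Continuous fun p => 4 * (C * 3 ^ (2 + α)) * dt p p' ^ (1 + α) :=
      continuous_const.mul ((continuous_dt_left p').rpow_const fun _ => Or.inr (by linarith))
    simpa [dt_self, Real.zero_rpow (by linarith : 1 + α ≠ 0)] using hc.tendsto p'
  have hc : Continuous fun p : ℝ × ℝ => b p' + 2 * q p * (p.1 - p'.1) := by fun_prop
  have := ht.add (hc.tendsto p')
  simp only [sub_self, mul_zero, add_zero, zero_add] at this
  refine this.congr fun p => ?_
  ring

theorem PolyApprox.coeff_eq (hα : 0 < α) (h : PolyApprox α f a b q d C) :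
    a = f ∧ b = d2 f ∧ q = (fun p => d2 (d2 f) p / 2) ∧ d = d3 f := by
  obtain rfl := h.eq_self hα
  have hb : b = d2 a := funext fun p => (h.hasDerivAt_fst hα p).deriv.symm
  refine ⟨rfl, hb, funext fun p => ?_, funext fun p => (h.hasDerivAt_snd hα p).deriv.symm⟩
  rw [← hb, d2, (h.hasDerivAt_coeff hα p).deriv]
  ring

theorem PolyApprox.c2aClass (hα : 0 < α) (hf : Bdd f) (hb : Bdd b) (hq : Bdd q) (hd : Bdd d)
    (h : PolyApprox α f a b q d C) : C2aClass α f := by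
  obtain ⟨rfl, hb', hq', hd'⟩ := h.coeff_eq hα
  have hqq : d2 (d2 a) = fun p => 2 * q p := by rw [hq']; funext p; ring
  have hcq : Continuous q := continuous_of_abs_sub_le_dt_rpow hα
    fun p p' => (h.coeff_sub_le_dt hα p p').1
  have hcd : Continuous d := continuous_of_abs_sub_le_dt_rpow hα
    fun p p' => (h.coeff_sub_le_dt hα p p').2.1
  unfold C2aClass
  rw [hqq, ← hb', ← hd']
  refine ⟨hf, fun p => (h.hasDerivAt_fst hα p).differentiableAt,
    fun p => (h.hasDerivAt_coeff hα p).differentiableAt,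
    fun p => (h.hasDerivAt_snd hα p).differentiableAt, h.continuous_coeff hα hcq,
    continuous_const.mul hcq, hcd, hb, ?_, hd,
    ⟨2 * (4 * (C * 3 ^ (2 + α))), fun p p' => ?_⟩,
    ⟨_, fun p p' => (h.coeff_sub_le_dt hα p p').2.1⟩⟩
  · obtain ⟨M, hM⟩ := hq
    refine ⟨2 * M, fun p => ?_⟩
    rw [abs_mul, abs_two]
    linarith [hM p]
  · rw [← mul_sub, abs_mul, abs_two]
    linarith [(h.coeff_sub_le_dt hα p p').1]

end PolyApprox

/-- For a bounded `f : ℝ² → ℝ`, membership in `C^{2,α}(Π)` is equivalent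
to the polynomial-approximation property `Γ^{2,α}(Π)` with bounded coefficients; moreover
the coefficients are necessarily `f`, `∂₂f`, `(1/2)∂₂²f`, `∂₃f`. -/
theorem stmt4 (α : ℝ) (hα : 0 < α) (hα1 : α < 1) (f : ℝ × ℝ → ℝ) (hf : Bdd f) :
    (C2aClass α f ↔
      ∃ C > (0 : ℝ), ∃ a b q d : ℝ × ℝ → ℝ,
        Bdd a ∧ Bdd b ∧ Bdd q ∧ Bdd d ∧ PolyApprox α f a b q d C) ∧
    (C2aClass α f →
      ∃ C > (0 : ℝ), PolyApprox α f f (d2 f) (fun p => d2 (d2 f) p / 2) (d3 f) C) ∧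
    (∀ C > (0 : ℝ), ∀ a b q d : ℝ × ℝ → ℝ,
      Bdd a → Bdd b → Bdd q → Bdd d → PolyApprox α f a b q d C →
        a = f ∧ b = d2 f ∧ q = (fun p => d2 (d2 f) p / 2) ∧ d = d3 f) := by
  refine ⟨⟨fun h => ?_, ?_⟩, fun h => h.exists_polyApprox hα,
    fun C _ a b q d _ _ _ _ h => h.coeff_eq hα⟩
  · obtain ⟨C, hC, hP⟩ := h.exists_polyApprox hα
    obtain ⟨-, -, -, -, -, -, -, hb, ⟨M, hM⟩, hd, -, -⟩ := h
    refine ⟨C, hC, f, d2 f, _, d3 f, hf, hb, ⟨M / 2, fun p => ?_⟩, hd, hP⟩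
    rw [abs_div, abs_two]
    linarith [hM p]
  · rintro ⟨C, -, a, b, q, d, -, hb, hq, hd, h⟩
    exact h.c2aClass hα hf hb hq hd
end
end
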